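/- For every integer m ≥ 2 and every real number q with 1/2 ≤ q ≤ 1, ∑_{k=0}^{m} C(m,k)·q^k·(1−q)^{m−k}·D(m,k) ≥ 0, where D(m,k) is defined in the context and C(m,k) is the binomial coefficient. (In words: for the uniform per-item value distribution and any q ≥ 1/2, the split attack (1,1),(1,1) is not beneficial in expectation for a bidder of true type (2,1); thus the granularity threshold of the split attack under the uniform distribution is at most 1/2.) -/

import Mathlib

open intervalIntegral

/-- Truthful minus split-attack utility of a bidder of true type (2,1) submitting the
false-name bids (1,1),(1,1), when the two highest one-item adversary per-item values are
`a ≥ b` and the highest two-item adversary per-item value is `w`. -/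
noncomputable def delta (w a b : ℝ) : ℝ :=
  if w ≤ (a + b) / 2 then a - b
  else if w ≤ (1 + a) / 2 then 2 * a - 2 * w
  else 2 * w - 2

/-- Expected value of `delta` for `m` adversaries with i.i.d. uniform per-item values on
[0,1], of which `k` demand one item, with respect to the relevant order statistics. -/
noncomputable def D (m k : ℕ) : ℝ :=
  if k = 0 then
    m * ∫ w in (0:ℝ)..1, w ^ (m - 1) * delta w 0 0
  else if k = 1 then
    ((m : ℝ) - 1) * ∫ v in (0:ℝ)..1, ∫ w in (0:ℝ)..1, w ^ (m - 2) * delta w v 0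
  else if k = m then
    (m : ℝ) * ((m : ℝ) - 1) *
      ∫ v₁ in (0:ℝ)..1, ∫ v₂ in (0:ℝ)..v₁, v₂ ^ (m - 2) * delta 0 v₁ v₂
  else
    (k : ℝ) * ((k : ℝ) - 1) * ((m : ℝ) - k) *
      ∫ v₁ in (0:ℝ)..1, ∫ v₂ in (0:ℝ)..v₁, ∫ w in (0:ℝ)..1,
        v₂ ^ (k - 2) * w ^ (m - k - 1) * delta w v₁ v₂

/-- The value of `∫ n w ^ (n - 1) * delta w a b` over `[0, 1]`; for `n = 0` it is `delta 0 a b`. -/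
noncomputable def meanDelta (n : ℕ) (a b : ℝ) : ℝ :=
  2 / ((n : ℝ) + 1) * (2 * ((1 + a) / 2) ^ (n + 1) - ((a + b) / 2) ^ (n + 1) - 1)

/-- The moment `∫ t ^ k * ((1 + t) / 2) ^ n` over `[0, 1]`. -/
noncomputable def moment (k n : ℕ) : ℝ :=
  ∫ t in (0:ℝ)..1, t ^ k * ((1 + t) / 2) ^ n

lemma hasDerivAt_pow_mul_pow (k n : ℕ) (t : ℝ) :
    HasDerivAt (fun t : ℝ => t ^ (k + 1) * ((1 + t) / 2) ^ (n + 1))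
      (((k : ℝ) + 1) * (t ^ k * ((1 + t) / 2) ^ (n + 1)) +
        ((n : ℝ) + 1) / 2 * (t ^ (k + 1) * ((1 + t) / 2) ^ n)) t := by
  have h₁ := hasDerivAt_pow (k + 1) t
  have h₂ := (((hasDerivAt_id t).const_add 1).div_const 2).pow (n + 1)
  refine (h₁.mul h₂).congr_deriv ?_
  simp
  ring

lemma intervalIntegrable_pow_mul_pow (k n : ℕ) (a b : ℝ) :
    IntervalIntegrable (fun t : ℝ => t ^ k * ((1 + t) / 2) ^ n) MeasureTheory.volume a b :=
  Continuous.intervalIntegrable (by fun_prop) a b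

lemma moment_by_parts (k n : ℕ) :
    ((k : ℝ) + 1) * moment k (n + 1) + ((n : ℝ) + 1) / 2 * moment (k + 1) n = 1 := by
  have h := integral_eq_sub_of_hasDerivAt (a := 0) (b := 1)
    (fun t _ => hasDerivAt_pow_mul_pow k n t)
    (Continuous.intervalIntegrable (by fun_prop) _ _)
  rw [integral_add ((intervalIntegrable_pow_mul_pow _ _ _ _).const_mul _)
    ((intervalIntegrable_pow_mul_pow _ _ _ _).const_mul _), integral_const_mul,
    integral_const_mul] at h
  rw [moment, moment, h]
  norm_num

lemma moment_succ_right (k n : ℕ) :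
    moment k (n + 1) = (moment k n + moment (k + 1) n) / 2 := by
  rw [moment, moment, moment, ← integral_add (intervalIntegrable_pow_mul_pow _ _ _ _)
    (intervalIntegrable_pow_mul_pow _ _ _ _), ← integral_div]
  congr 1
  ext t
  ring

lemma integral_half_pow (n : ℕ) :
    ∫ t in (0:ℝ)..1, ((1 + t) / 2) ^ n = 2 * (1 - (1 / 2) ^ (n + 1)) / ((n : ℝ) + 1) := by
  have h (t : ℝ) : HasDerivAt (fun t : ℝ => 2 / ((n : ℝ) + 1) * ((1 + t) / 2) ^ (n + 1))
      (((1 + t) / 2) ^ n) t := by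
    refine ((((hasDerivAt_id t).const_add 1).div_const 2).pow (n + 1)
      |>.const_mul (2 / ((n : ℝ) + 1))).congr_deriv ?_
    simp
    field_simp
  rw [integral_eq_sub_of_hasDerivAt (fun t _ => h t)
    (Continuous.intervalIntegrable (by fun_prop) _ _)]
  norm_num
  ring

lemma moment_zero_left (n : ℕ) :
    moment 0 n = 2 * (1 - (1 / 2) ^ (n + 1)) / ((n : ℝ) + 1) := by
  simp only [moment, pow_zero, one_mul, integral_half_pow]

lemma succ_mul_integral_pow_mul_delta (n : ℕ) {a b : ℝ} (hb : 0 ≤ b) (hab : b ≤ a) (ha : a ≤ 1) :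
    ((n : ℝ) + 1) * ∫ w in (0:ℝ)..1, w ^ n * delta w a b = meanDelta (n + 1) a b := by
  have h₁ : Set.EqOn (fun w => w ^ n * (a - b)) (fun w => w ^ n * delta w a b)
      (Set.uIcc 0 ((a + b) / 2)) := by
    intro w hw
    rw [Set.uIcc_of_le (by linarith)] at hw
    simp only [delta, if_pos hw.2]
  have h₂ : Set.EqOn (fun w => w ^ n * (2 * a - 2 * w)) (fun w => w ^ n * delta w a b)
      (Set.uIcc ((a + b) / 2) ((1 + a) / 2)) := by
    intro w hw
    rw [Set.uIcc_of_le (by linarith)] at hw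
    simp only [delta, if_pos hw.2]
    split_ifs with h
    · rw [le_antisymm h hw.1]; ring
    · rfl
  have h₃ : Set.EqOn (fun w => w ^ n * (2 * w - 2)) (fun w => w ^ n * delta w a b)
      (Set.uIcc ((1 + a) / 2) 1) := by
    intro w hw
    rw [Set.uIcc_of_le (by linarith)] at hw
    simp only [delta]
    split_ifs with h h'
    · have := hw.1
      have : w = 1 := by linarith
      have : a = 1 := by linarith
      have : b = 1 := by linarith
      subst_vars; ring
    · rw [le_antisymm h' hw.1]; ring
    · rfl
  have i₁ : IntervalIntegrable (fun w => w ^ n * delta w a b) MeasureTheory.volume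
      0 ((a + b) / 2) :=
    (Continuous.intervalIntegrable (by fun_prop) _ _).congr (h₁.mono Set.uIoc_subset_uIcc)
  have i₂ : IntervalIntegrable (fun w => w ^ n * delta w a b) MeasureTheory.volume
      ((a + b) / 2) ((1 + a) / 2) :=
    (Continuous.intervalIntegrable (by fun_prop) _ _).congr (h₂.mono Set.uIoc_subset_uIcc)
  have i₃ : IntervalIntegrable (fun w => w ^ n * delta w a b) MeasureTheory.volume
      ((1 + a) / 2) 1 :=
    (Continuous.intervalIntegrable (by fun_prop) _ _).congr (h₃.mono Set.uIoc_subset_uIcc)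
  have affine (c d x y : ℝ) : ∫ w in x..y, w ^ n * (c + d * w) =
      (c * (y ^ (n + 1) / (n + 1)) + d * (y ^ (n + 2) / (n + 2))) -
        (c * (x ^ (n + 1) / (n + 1)) + d * (x ^ (n + 2) / (n + 2))) := by
    refine integral_eq_sub_of_hasDerivAt
      (f := fun w : ℝ => c * (w ^ (n + 1) / (n + 1)) + d * (w ^ (n + 2) / (n + 2)))
      (fun w _ => ?_) (Continuous.intervalIntegrable (by fun_prop) _ _)
    refine ((((hasDerivAt_pow (n + 1) w).div_const _).const_mul c).add
      (((hasDerivAt_pow (n + 2) w).div_const _).const_mul d)).congr_deriv ?_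
    simp only [Nat.add_sub_cancel, show n + 2 - 1 = n + 1 from rfl]
    push_cast
    field_simp
    ring
  rw [← integral_add_adjacent_intervals (i₁.trans i₂) i₃, ← integral_add_adjacent_intervals i₁ i₂,
    ← integral_congr h₁, ← integral_congr h₂, ← integral_congr h₃,
    show (fun w : ℝ => w ^ n * (a - b)) = fun w => w ^ n * ((a - b) + 0 * w) by ext; ring,
    show (fun w : ℝ => w ^ n * (2 * a - 2 * w)) = fun w => w ^ n * (2 * a + (-2) * w) by
      ext; ring,
    show (fun w : ℝ => w ^ n * (2 * w - 2)) = fun w => w ^ n * (-2 + 2 * w) by ext; ring,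
    affine, affine, affine, meanDelta]
  push_cast
  field_simp
  ring_nf

lemma delta_zero_eq_meanDelta {a b : ℝ} (hb : 0 ≤ b) (hab : b ≤ a) : delta 0 a b = meanDelta 0 a b := by
  rw [delta, if_pos (by linarith), meanDelta]
  norm_num
  ring

lemma integral_pow_mul_midpoint_pow (j n : ℕ) (v : ℝ) :
    ∫ y in (0:ℝ)..v, y ^ j * ((v + y) / 2) ^ n = v ^ (j + n + 1) * moment j n := by
  have h := mul_integral_comp_mul_left (a := 0) (b := 1)
    (f := fun y => y ^ j * ((v + y) / 2) ^ n) v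
  rw [mul_zero, mul_one] at h
  rw [← h, moment, pow_succ', mul_assoc, ← integral_const_mul (v ^ (j + n))]
  congr 1
  refine integral_congr fun t _ => ?_
  rw [show (v + v * t) / 2 = v * ((1 + t) / 2) by ring, mul_pow, mul_pow]
  ring

lemma integral_pow_mul_meanDelta (j n : ℕ) (v : ℝ) :
    ∫ y in (0:ℝ)..v, y ^ j * meanDelta n v y =
      2 / ((n : ℝ) + 1) * ((2 * (v ^ (j + 1) * ((1 + v) / 2) ^ (n + 1)) - v ^ (j + 1)) /
        ((j : ℝ) + 1) - v ^ (j + n + 2) * moment j (n + 1)) := by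
  rw [show (fun y : ℝ => y ^ j * meanDelta n v y) = fun y =>
      2 / ((n : ℝ) + 1) * (y ^ j * (2 * ((1 + v) / 2) ^ (n + 1) - 1) -
        y ^ j * ((v + y) / 2) ^ (n + 1)) by ext; rw [meanDelta]; ring,
    integral_const_mul, integral_sub (Continuous.intervalIntegrable (by fun_prop) _ _)
      (Continuous.intervalIntegrable (by fun_prop) _ _), integral_pow_mul_midpoint_pow,
    integral_mul_const, integral_pow]
  simp only [zero_pow (Nat.succ_ne_zero j)]
  ring

lemma double_integral_meanDelta (j n : ℕ) :
    ((j : ℝ) + 2) * ((j : ℝ) + 1) *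
        ∫ v in (0:ℝ)..1, ∫ y in (0:ℝ)..v, y ^ j * meanDelta n v y =
      4 / ((j : ℝ) + n + 3) - 3 * moment (j + 2) n := by
  have h₁ := moment_by_parts (j + 1) n
  have h₂ := moment_by_parts j n
  have h₃ := moment_succ_right (j + 1) n
  simp only [integral_pow_mul_meanDelta]
  rw [integral_const_mul, integral_sub (Continuous.intervalIntegrable (by fun_prop) _ _)
      (Continuous.intervalIntegrable (by fun_prop) _ _), integral_div,
    integral_sub (Continuous.intervalIntegrable (by fun_prop) _ _)
      (Continuous.intervalIntegrable (by fun_prop) _ _), integral_const_mul, integral_mul_const,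
    integral_pow, integral_pow]
  rw [← moment]
  push_cast at h₁ h₂ h₃ ⊢
  simp only [one_pow, zero_pow (Nat.succ_ne_zero _)]
  have e₁ : moment (j + 1) (n + 1) = (1 - (n + 1) / 2 * moment (j + 2) n) / (j + 2) := by
    rw [eq_div_iff (by positivity)]
    linear_combination h₁
  have e₂ : moment (j + 1) n = 2 * moment (j + 1) (n + 1) - moment (j + 2) n := by
    linear_combination -2 * h₃
  have e₃ : moment j (n + 1) = (1 - (n + 1) / 2 * moment (j + 1) n) / (j + 1) := by
    rw [eq_div_iff (by positivity)]
    linear_combination h₂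
  rw [e₃, e₂, e₁]
  field_simp
  ring

lemma D_eq (m k : ℕ) (hm : 2 ≤ m) (hk : k ≤ m) :
    D m k = 4 / ((m : ℝ) + 1) - (if k = 0 then (1 / 2) ^ m / ((m : ℝ) + 1) else 0) -
      3 * moment k (m - k) := by
  rcases k with _ | _ | j
  · obtain ⟨n, rfl⟩ : ∃ n, m = n + 1 := ⟨m - 1, by omega⟩
    have h := succ_mul_integral_pow_mul_delta n le_rfl le_rfl zero_le_one
    simp only [D, if_true, Nat.add_sub_cancel, Nat.sub_zero, moment_zero_left]
    push_cast
    rw [h, meanDelta]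
    push_cast
    simp only [add_zero, zero_div, zero_pow (Nat.succ_ne_zero _)]
    field_simp
    ring
  · obtain ⟨n, rfl⟩ : ∃ n, m = n + 2 := ⟨m - 2, by omega⟩
    have hc : ∀ v ∈ Set.uIcc (0:ℝ) 1,
        ((n : ℝ) + 1) * ∫ w in (0:ℝ)..1, w ^ n * delta w v 0 = meanDelta (n + 1) v 0 := by
      intro v hv
      rw [Set.uIcc_of_le zero_le_one] at hv
      exact succ_mul_integral_pow_mul_delta n le_rfl hv.1 hv.2
    have h₁ := moment_by_parts 0 (n + 1)
    have h₂ := moment_zero_left (n + 2)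
    have hd : D (n + 2) 1 = ∫ v in (0:ℝ)..1, meanDelta (n + 1) v 0 := by
      rw [← integral_congr hc, integral_const_mul]
      simp only [D, one_ne_zero, if_false, if_true, Nat.add_sub_cancel]
      push_cast
      ring
    have he : (fun v => meanDelta (n + 1) v 0) = fun v : ℝ => 2 / ((n : ℝ) + 2) *
        (2 * ((1 + v) / 2) ^ (n + 2) - v ^ (n + 2) * (1 / 2) ^ (n + 2) - 1) := by
      ext v
      rw [meanDelta, add_zero, ← mul_pow, mul_one_div]
      push_cast
      ring
    rw [zero_add, hd, he, integral_const_mul,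
      integral_sub (Continuous.intervalIntegrable (by fun_prop) _ _)
        (Continuous.intervalIntegrable (by fun_prop) _ _),
      integral_sub (Continuous.intervalIntegrable (by fun_prop) _ _)
        (Continuous.intervalIntegrable (by fun_prop) _ _),
      integral_const_mul, integral_mul_const, integral_pow, integral_half_pow]
    simp only [one_ne_zero, if_false, show n + 2 - 1 = n + 1 from rfl]
    have e₁ : moment 1 (n + 1) = (1 - moment 0 (n + 2)) * 2 / (n + 2) := by
      push_cast at h₁
      field_simp
      linear_combination 2 * h₁
    rw [e₁, h₂]
    simp
    field_simp
    ring
  · have hdbl := double_integral_meanDelta j (m - (j + 2))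
    rcases hk.eq_or_lt with rfl | hlt
    · rw [D, if_neg (by omega), if_neg (by omega), if_pos rfl]
      have hc : ∀ v ∈ Set.uIcc (0:ℝ) 1,
          ∫ y in (0:ℝ)..v, y ^ j * delta 0 v y = ∫ y in (0:ℝ)..v, y ^ j * meanDelta 0 v y := by
        intro v hv
        rw [Set.uIcc_of_le zero_le_one] at hv
        refine integral_congr fun y hy => ?_
        rw [Set.uIcc_of_le hv.1] at hy
        simp only [delta_zero_eq_meanDelta hy.1 hy.2]
      simp only [show j + 1 + 1 - 2 = j from rfl]
      rw [integral_congr hc]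
      simp only [Nat.sub_self] at hdbl ⊢
      rw [if_neg (by omega)]
      push_cast at hdbl ⊢
      ring_nf at hdbl ⊢
      linear_combination hdbl
    · obtain ⟨n, rfl⟩ : ∃ n, m = j + 2 + n + 1 := ⟨m - j - 3, by omega⟩
      rw [D, if_neg (by omega), if_neg (by omega), if_neg (by omega)]
      have hc : ∀ v ∈ Set.uIcc (0:ℝ) 1,
          ((n : ℝ) + 1) * ∫ y in (0:ℝ)..v, ∫ w in (0:ℝ)..1, y ^ j * w ^ n * delta w v y =
            ∫ y in (0:ℝ)..v, y ^ j * meanDelta (n + 1) v y := by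
        intro v hv
        rw [Set.uIcc_of_le zero_le_one] at hv
        rw [← integral_const_mul]
        refine integral_congr fun y hy => ?_
        rw [Set.uIcc_of_le hv.1] at hy
        simp only [mul_assoc, integral_const_mul]
        rw [← succ_mul_integral_pow_mul_delta n hy.1 hy.2 hv.2]
        ring
      rw [show j + 2 + n + 1 - (j + 2) = n + 1 by omega, ← integral_congr hc,
        integral_const_mul] at hdbl
      rw [show j + 2 + n + 1 - (j + 1 + 1) = n + 1 by omega, if_neg (by omega)]
      simp only [show j + 1 + 1 - 2 = j from rfl, Nat.add_sub_cancel]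
      push_cast at hdbl ⊢
      ring_nf at hdbl ⊢
      linear_combination hdbl

lemma sum_binomial_moment (m : ℕ) (q : ℝ) (hq : 1 + q ≠ 0) :
    ∑ k ∈ Finset.range (m + 1), (m.choose k : ℝ) * q ^ k * (1 - q) ^ (m - k) * moment k (m - k) =
      2 * (1 - ((1 - q) / 2) ^ (m + 1)) / (((m : ℝ) + 1) * (1 + q)) := by
  have hd (t : ℝ) : HasDerivAt
      (fun t : ℝ => 2 / (((m : ℝ) + 1) * (1 + q)) * ((1 - q) / 2 + (1 + q) / 2 * t) ^ (m + 1))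
      (((1 - q) / 2 + (1 + q) / 2 * t) ^ m) t := by
    refine (((((hasDerivAt_id t).const_mul ((1 + q) / 2)).const_add ((1 - q) / 2)).pow (m + 1)
      ).const_mul (2 / (((m : ℝ) + 1) * (1 + q)))).congr_deriv ?_
    simp
    field_simp
  have hi := integral_eq_sub_of_hasDerivAt (a := 0) (b := 1) (fun t _ => hd t)
    (Continuous.intervalIntegrable (by fun_prop) _ _)
  have he : (fun t : ℝ => ((1 - q) / 2 + (1 + q) / 2 * t) ^ m) = fun t =>
      ∑ k ∈ Finset.range (m + 1), (m.choose k : ℝ) * q ^ k * (1 - q) ^ (m - k) *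
        (t ^ k * ((1 + t) / 2) ^ (m - k)) := by
    ext t
    rw [show (1 - q) / 2 + (1 + q) / 2 * t = q * t + (1 - q) * ((1 + t) / 2) by ring, add_pow]
    refine Finset.sum_congr rfl fun k _ => ?_
    rw [mul_pow, mul_pow]
    ring
  rw [he, integral_finsetSum fun k _ => (intervalIntegrable_pow_mul_pow _ _ _ _).const_mul _] at hi
  simp only [integral_const_mul] at hi
  simp only [moment]
  rw [hi, show (1 - q) / 2 + (1 + q) / 2 * 1 = 1 by ring, mul_zero, add_zero]
  ring

lemma sum_binomial_D (m : ℕ) (hm : 2 ≤ m) (q : ℝ) (hq : 1 + q ≠ 0) :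
    ∑ k ∈ Finset.range (m + 1), (m.choose k : ℝ) * q ^ k * (1 - q) ^ (m - k) * D m k =
      2 * (2 * q - 1) / (((m : ℝ) + 1) * (1 + q)) * (1 - ((1 - q) / 2) ^ m) := by
  have hsum : ∑ k ∈ Finset.range (m + 1), (m.choose k : ℝ) * q ^ k * (1 - q) ^ (m - k) = 1 := by
    have h := add_pow q (1 - q) m
    rw [add_sub_cancel, one_pow] at h
    exact (Finset.sum_congr rfl fun k _ => by ring).trans h.symm
  have hterm : ∀ k ∈ Finset.range (m + 1),
      (m.choose k : ℝ) * q ^ k * (1 - q) ^ (m - k) * D m k =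
        (m.choose k : ℝ) * q ^ k * (1 - q) ^ (m - k) * (4 / ((m : ℝ) + 1)) -
        (if k = 0 then (1 - q) ^ m * ((1 / 2) ^ m / ((m : ℝ) + 1)) else 0) -
        3 * ((m.choose k : ℝ) * q ^ k * (1 - q) ^ (m - k) * moment k (m - k)) := by
    intro k hk
    rw [D_eq m k hm (by simpa [Nat.lt_succ_iff] using hk)]
    split_ifs with h
    · subst h
      simp
      ring
    · ring
  rw [Finset.sum_congr rfl hterm, Finset.sum_sub_distrib, Finset.sum_sub_distrib,
    ← Finset.sum_mul, hsum, ← Finset.mul_sum, sum_binomial_moment m q hq,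
    Finset.sum_ite_eq' _ 0, if_pos (by simp), ← mul_div_assoc, ← mul_div_assoc, ← mul_pow,
    mul_one_div]
  field_simp
  ring

theorem stmt_10 (m : ℕ) (hm : 2 ≤ m) (q : ℝ) (hq : 1 / 2 ≤ q) (hq1 : q ≤ 1) :
    ∑ k ∈ Finset.range (m + 1), (m.choose k : ℝ) * q ^ k * (1 - q) ^ (m - k) * D m k ≥ 0 := by
  have hpow : ((1 - q) / 2) ^ m ≤ 1 := pow_le_one₀ (by linarith) (by linarith)
  rw [sum_binomial_D m hm q (by linarith), ge_iff_le]
  exact mul_nonneg (div_nonneg (by linarith) (mul_nonneg (by positivity) (by linarith)))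
    (by linarith)
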